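/- arXiv:2602.15784 — 12 statements merged into one kernel-verified Lean document; each statement's English description precedes it below -/
import Mathlib

section
/- Consider the distance preservation game with three agents a_1, a_2, a_3 on the topology G equal to the cycle on four vertices, where M_{a_1} = {a_2}, M_{a_2} = {a_3}, M_{a_3} = {a_1}, and each agent's ideal distance to the agent in its relationship set is 2. This game admits no envy-free allocation. -/
open Finset

/-- A distance preservation game: a finite set of agents `A`, relationship sets `M a`,
ideal distance functions `d a`, and a topology `G` — a connected simple graph on a
finite vertex set `V` with at least as many vertices as agents. -/
structure DPG (A V : Type) [Fintype A] [DecidableEq A] [Fintype V] where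
  G : SimpleGraph V
  conn : G.Connected
  M : A → Finset A
  M_irr : ∀ a : A, a ∉ M a
  d : A → A → ℕ
  d_pos : ∀ a b : A, b ∈ M a → 0 < d a b
  card_le : Fintype.card A ≤ Fintype.card V

variable {A V : Type} [Fintype A] [DecidableEq A] [Fintype V]

/-- The cost of agent `a` under allocation `π`. -/
noncomputable def DPG.cost (Γ : DPG A V) (π : A → V) (a : A) : ℕ :=
  ∑ b ∈ Γ.M a, ((Γ.d a b : ℤ) - (Γ.G.dist (π a) (π b) : ℤ)).natAbs

/-- The allocation obtained from `π` by swapping the positions of `a` and `b`. -/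
def swapAlloc (π : A → V) (a b : A) : A → V := π ∘ Equiv.swap a b

/-- An allocation is envy-free if no agent strictly decreases their cost by
taking the position of another agent. -/
def DPG.EnvyFree (Γ : DPG A V) (π : A → V) : Prop :=
  ∀ a b : A, a ≠ b → ¬ (Γ.cost π a > Γ.cost (swapAlloc π a b) a)

/-- An allocation is swap stable if no pair of distinct agents both strictly decrease
their costs by swapping positions. -/
def DPG.SwapStable (Γ : DPG A V) (π : A → V) : Prop :=
  ∀ a b : A, a ≠ b →
    ¬ (Γ.cost π a > Γ.cost (swapAlloc π a b) a ∧ Γ.cost π b > Γ.cost (swapAlloc π a b) b)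

/-- An allocation is jump stable if no agent strictly decreases their cost by
jumping to an empty vertex. -/
def DPG.JumpStable (Γ : DPG A V) (π : A → V) : Prop :=
  ∀ (a : A) (v : V), (∀ b : A, π b ≠ v) →
    ¬ (Γ.cost π a > Γ.cost (Function.update π a v) a)

/-- Distances in the 4-cycle. -/
theorem dist_cycleGraph_four (u v : Fin 4) :
    (SimpleGraph.cycleGraph 4).dist u v = if u = v then 0 else if v = u + 2 then 2 else 1 := by
  have hadj : ∀ x : Fin 4, (SimpleGraph.cycleGraph 4).Adj x (x + 1) := by decide
  have hnadj : ∀ x : Fin 4, ¬ (SimpleGraph.cycleGraph 4).Adj x (x + 2) := by decide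
  split_ifs with h₁ h₂
  · simp [h₁]
  · subst h₂
    have hadj' : (SimpleGraph.cycleGraph 4).Adj (u + 1) (u + 2) := by
      have := hadj (u + 1)
      rwa [add_assoc] at this
    let p : (SimpleGraph.cycleGraph 4).Walk u (u + 2) := .cons (hadj u) (.cons hadj' .nil)
    have hle : (SimpleGraph.cycleGraph 4).dist u (u + 2) ≤ 2 := SimpleGraph.dist_le p
    have hpos := p.reachable.pos_dist_of_ne h₁
    have hne : (SimpleGraph.cycleGraph 4).dist u (u + 2) ≠ 1 := by
      rw [Ne, SimpleGraph.dist_eq_one_iff_adj]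
      exact hnadj u
    omega
  · rw [SimpleGraph.dist_eq_one_iff_adj]
    clear hadj hnadj
    revert u v
    decide

/-- The game with three agents `a_1, a_2, a_3` on the 4-cycle, where each agent
`a_i` cares only about `a_{(i mod 3)+1}` with ideal distance 2, admits no envy-free
allocation. -/
theorem cycle4_no_envyFree (Γ : DPG (Fin 3) (Fin 4))
    (hG : Γ.G = SimpleGraph.cycleGraph 4)
    (hM : ∀ i : Fin 3, Γ.M i = {i + 1})
    (hd : ∀ i : Fin 3, Γ.d i (i + 1) = 2) :
    ¬ ∃ π : Fin 3 → Fin 4, Function.Injective π ∧ Γ.EnvyFree π := by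
  rintro ⟨π, hinj, hef⟩
  simp only [DPG.EnvyFree, DPG.cost, hM, sum_singleton, hd, hG, dist_cycleGraph_four,
    swapAlloc, Function.comp_apply] at hef
  revert π
  decide
end

section
/- For every number of agents n ≥ 3, there exists a distance preservation game with exactly n agents that admits no envy-free allocation. -/
open Finset

variable {A V : Type} [Fintype A] [DecidableEq A] [Fintype V]

/-- Every agent wants to be adjacent to every other agent, and the topology is a star whose
vertices are all occupied. -/
def starGame (n : ℕ) (c : Fin n) : DPG (Fin n) (Fin n) where
  G := SimpleGraph.starGraph c
  conn := SimpleGraph.connected_starGraph c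
  M a := univ.erase a
  M_irr a := notMem_erase a univ
  d _ _ := 1
  d_pos _ _ _ := one_pos
  card_le := le_rfl

lemma starGame_cost_eq_zero_iff {n : ℕ} (c : Fin n) (π : Fin n → Fin n) (a : Fin n) :
    (starGame n c).cost π a = 0 ↔
      ∀ b, b ≠ a → (SimpleGraph.starGraph c).Adj (π a) (π b) := by
  simp only [DPG.cost, starGame, sum_eq_zero_iff, mem_erase, mem_univ, and_true,
    ← SimpleGraph.dist_eq_one_iff_adj]
  refine forall₂_congr fun b _ => ?_
  omega

/-- For every number of agents `n ≥ 3`, there exists a distance preservation game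
with exactly `n` agents that admits no envy-free allocation. -/
theorem exists_game_no_envyFree (n : ℕ) (hn : 3 ≤ n) :
    ∃ (m : ℕ) (Γ : DPG (Fin n) (Fin m)),
      ¬ ∃ π : Fin n → Fin m, Function.Injective π ∧ Γ.EnvyFree π := by
  let c : Fin n := ⟨0, by omega⟩
  refine ⟨n, starGame n c, ?_⟩
  rintro ⟨π, hπ, hfree⟩
  obtain ⟨z, hz⟩ := Finite.surjective_of_injective hπ c
  obtain ⟨a, ha⟩ : ∃ a, a ∉ ({z} : Finset (Fin n)) :=
    exists_mem_notMem_of_card_lt_card (s := {z}) (t := univ) (by simp; omega) |>.imp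
      fun _ h => h.2
  obtain ⟨b, hb⟩ : ∃ b, b ∉ ({z, a} : Finset (Fin n)) :=
    exists_mem_notMem_of_card_lt_card (s := {z, a}) (t := univ)
      (card_le_two.trans_lt (by simp; omega)) |>.imp fun _ h => h.2
  simp only [mem_insert, mem_singleton, not_or] at ha hb
  have hne : ∀ x, x ≠ z → π x ≠ c := fun x hx h => hx (hπ (h.trans hz.symm))
  have hswap : (starGame n c).cost (swapAlloc π a z) a = 0 := by
    refine (starGame_cost_eq_zero_iff c _ a).2 fun x hx => ?_
    have hx' : Equiv.swap a z x ≠ z := fun h => hx ((Equiv.swap a z).injective (by simpa using h))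
    simpa [swapAlloc, hz] using (hne _ hx').symm
  have hcost : (starGame n c).cost π a ≠ 0 := fun h => by
    have := (starGame_cost_eq_zero_iff c π a).1 h b hb.2
    simp [hne a ha, hne b hb.1] at this
  exact hfree a z ha (by rw [hswap]; exact Nat.pos_of_ne_zero hcost)
end

section
/- There exists a distance preservation game that admits a swap stable allocation but admits no envy-free allocation. Concretely, in the game with three agents a_1, a_2, a_3 on the 4-cycle with consecutive vertices v_1, v_2, v_3, v_4, where M_{a_1} = {a_2}, M_{a_2} = {a_3}, M_{a_3} = {a_1} and every ideal distance equals 2, the allocation π(a_1) = v_1, π(a_3) = v_2, π(a_2) = v_3 is swap stable, while no allocation of this game is envy-free. -/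
open Finset

variable {A V : Type} [Fintype A] [DecidableEq A] [Fintype V]

/-- The game with three agents `a_1, a_2, a_3` on the 4-cycle (with consecutive
vertices `v_1 = 0, v_2 = 1, v_3 = 2, v_4 = 3`), where each `a_i` cares only about
`a_{(i mod 3)+1}` with ideal distance 2, admits the swap stable allocation
`π(a_1) = v_1, π(a_3) = v_2, π(a_2) = v_3`, but admits no envy-free allocation. -/
theorem swapStable_not_envyFree (Γ : DPG (Fin 3) (Fin 4))
    (hG : Γ.G = SimpleGraph.cycleGraph 4)
    (hM : ∀ i : Fin 3, Γ.M i = {i + 1})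
    (hd : ∀ i : Fin 3, Γ.d i (i + 1) = 2) :
    (Function.Injective (![0, 2, 1] : Fin 3 → Fin 4) ∧
        Γ.SwapStable (![0, 2, 1] : Fin 3 → Fin 4)) ∧
      ¬ ∃ π : Fin 3 → Fin 4, Function.Injective π ∧ Γ.EnvyFree π := by
  have hcost (π : Fin 3 → Fin 4) (a : Fin 3) : Γ.cost π a =
      2 - if π a = π (a + 1) then 0 else if π (a + 1) = π a + 2 then 2 else 1 := by
    rw [DPG.cost, hM, sum_singleton, hd, hG, dist_cycleGraph_four]
    split_ifs <;> rfl
  simp only [DPG.SwapStable, DPG.EnvyFree, hcost, swapAlloc]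
  refine ⟨⟨by decide, by decide⟩, ?_⟩
  rintro ⟨π, hinj, hπ⟩
  have hne : π 0 ≠ π 1 ∧ π 0 ≠ π 2 ∧ π 1 ≠ π 2 := by simp [hinj.eq_iff]
  have h₀ := hπ 0 2 (by decide)
  have h₁ := hπ 1 0 (by decide)
  have h₂ := hπ 2 1 (by decide)
  simp only [Function.comp_apply, show (0 : Fin 3) + 1 = 1 from rfl,
    show (1 : Fin 3) + 1 = 2 from rfl, show (2 : Fin 3) + 1 = 0 from rfl,
    show Equiv.swap (0 : Fin 3) 2 0 = 2 by decide, show Equiv.swap (0 : Fin 3) 2 1 = 1 by decide,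
    show Equiv.swap (1 : Fin 3) 0 1 = 0 by decide, show Equiv.swap (1 : Fin 3) 0 2 = 2 by decide,
    show Equiv.swap (2 : Fin 3) 1 2 = 1 by decide, show Equiv.swap (2 : Fin 3) 1 0 = 0 by decide]
    at h₀ h₁ h₂
  generalize π 0 = x, π 1 = y, π 2 = z at hne h₀ h₁ h₂
  clear hπ hinj π hcost hG hM hd Γ
  revert x y z
  decide
end

section
/- A distance preservation game Γ = (A, (M_a), (d_a), G) admits an allocation that is simultaneously envy-free and jump stable if and only if the distance preservation game Γ' = (A', (M'_a), (d'_a), G) admits an envy-free allocation, where A' = A ∪ {x_1, …, x_{|V(G)|−|A|}} consists of the original agents together with |V(G)| − |A| new indifferent agents, M'_a = M_a and d'_a = d_a for every a ∈ A, and M'_{x_i} = ∅ for every new agent x_i. -/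
open Finset

variable {A V : Type} [Fintype A] [DecidableEq A] [Fintype V]

/-- Adding indifferent agents does not change the costs of the original agents. -/
theorem DPG.cost_inl {B : Type} [Fintype B] [DecidableEq B] (Γ : DPG A V) (Γ' : DPG (A ⊕ B) V)
    (hG : Γ'.G = Γ.G)
    (hM : ∀ a : A, Γ'.M (Sum.inl a) = (Γ.M a).image Sum.inl)
    (hd : ∀ a b : A, Γ'.d (Sum.inl a) (Sum.inl b) = Γ.d a b)
    (π : A ⊕ B → V) (a : A) : Γ'.cost π (Sum.inl a) = Γ.cost (π ∘ Sum.inl) a := by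
  unfold DPG.cost
  rw [hM, Finset.sum_image Sum.inl_injective.injOn]
  simp [hd, hG]

theorem swapAlloc_inl_inl {A B V : Type} [DecidableEq A] [DecidableEq B]
    (π : A ⊕ B → V) (a b : A) :
    swapAlloc π (Sum.inl a) (Sum.inl b) ∘ Sum.inl = swapAlloc (π ∘ Sum.inl) a b := by
  funext c
  simp only [swapAlloc, Function.comp_apply, Equiv.swap_apply_def, Sum.inl.injEq]
  split_ifs <;> rfl

theorem swapAlloc_inl_inr {A B V : Type} [DecidableEq A] [DecidableEq B]
    (π : A ⊕ B → V) (a : A) (x : B) :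
    swapAlloc π (Sum.inl a) (Sum.inr x) ∘ Sum.inl =
      Function.update (π ∘ Sum.inl) a (π (Sum.inr x)) := by
  funext c
  by_cases h : c = a
  · subst h
    simp [swapAlloc]
  · simp [swapAlloc, Equiv.swap_apply_def, h]

/-- An injective map `A → V` extends to a bijection from `A` padded up to the size of `V`. -/
theorem exists_bijective_extension {A V : Type} [Fintype A] [Fintype V]
    (π : A → V) (hπ : Function.Injective π) :
    ∃ π' : A ⊕ Fin (Fintype.card V - Fintype.card A) → V,
      Function.Bijective π' ∧ π' ∘ Sum.inl = π := by
  classical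
  have hcard : Fintype.card (Fin (Fintype.card V - Fintype.card A)) =
      Fintype.card ↥(Set.range π)ᶜ := by
    rw [Fintype.card_fin, Fintype.card_compl_set, Set.card_range_of_injective hπ]
  let e := (Equiv.sumCongr (Equiv.ofInjective π hπ) (Fintype.equivOfCardEq hcard)).trans
    (Equiv.Set.sumCompl (Set.range π))
  exact ⟨e, e.bijective, by funext a; simp [e]⟩

/-- For a bijective padded allocation, envy-freeness amounts to envy-freeness together with
jump stability of its restriction to the original agents. -/
theorem DPG.envyFree_padded_iff {B : Type} [Fintype B] [DecidableEq B]
    (Γ : DPG A V) (Γ' : DPG (A ⊕ B) V)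
    (hG : Γ'.G = Γ.G)
    (hM : ∀ a : A, Γ'.M (Sum.inl a) = (Γ.M a).image Sum.inl)
    (hd : ∀ a b : A, Γ'.d (Sum.inl a) (Sum.inl b) = Γ.d a b)
    (hMx : ∀ x : B, Γ'.M (Sum.inr x) = ∅)
    (π : A ⊕ B → V) (hπ : Function.Bijective π) :
    Γ'.EnvyFree π ↔ Γ.EnvyFree (π ∘ Sum.inl) ∧ Γ.JumpStable (π ∘ Sum.inl) := by
  have hcost := Γ.cost_inl Γ' hG hM hd
  constructor
  · refine fun h => ⟨fun a b hab => ?_, fun a v hv => ?_⟩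
    · have := h (Sum.inl a) (Sum.inl b) (by simpa using hab)
      rwa [hcost, hcost, swapAlloc_inl_inl] at this
    · obtain ⟨c | x, rfl⟩ := hπ.surjective v
      · exact absurd rfl (hv c)
      · have := h (Sum.inl a) (Sum.inr x) Sum.inl_ne_inr
        rwa [hcost, hcost, swapAlloc_inl_inr] at this
  · rintro ⟨hE, hJ⟩ (a | x) c hac
    · rw [hcost, hcost]
      rcases c with b | x
      · rw [swapAlloc_inl_inl]
        exact hE a b (by simpa using hac)
      · rw [swapAlloc_inl_inr]
        exact hJ a _ fun b hb => Sum.inl_ne_inr (hπ.injective hb)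
    · simp [DPG.cost, hMx]

/-- A game `Γ` admits an envy-free and jump stable allocation iff the game `Γ'`
obtained from `Γ` by adding `|V| - |A|` indifferent agents (on the same topology)
admits an envy-free allocation. -/
theorem envyFree_jumpStable_iff_padded_envyFree (Γ : DPG A V)
    (Γ' : DPG (A ⊕ Fin (Fintype.card V - Fintype.card A)) V)
    (hG : Γ'.G = Γ.G)
    (hM : ∀ a : A, Γ'.M (Sum.inl a) = (Γ.M a).image Sum.inl)
    (hd : ∀ a b : A, Γ'.d (Sum.inl a) (Sum.inl b) = Γ.d a b)
    (hMx : ∀ x : Fin (Fintype.card V - Fintype.card A), Γ'.M (Sum.inr x) = ∅) :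
    (∃ π : A → V, Function.Injective π ∧ Γ.EnvyFree π ∧ Γ.JumpStable π) ↔
      (∃ π' : A ⊕ Fin (Fintype.card V - Fintype.card A) → V,
        Function.Injective π' ∧ Γ'.EnvyFree π') := by
  constructor
  · rintro ⟨π, hπ, hE, hJ⟩
    obtain ⟨π', hbij, rfl⟩ := exists_bijective_extension π hπ
    exact ⟨π', hbij.injective, (Γ.envyFree_padded_iff Γ' hG hM hd hMx π' hbij).2 ⟨hE, hJ⟩⟩
  · rintro ⟨π', hinj, hE⟩
    have hbij : Function.Bijective π' := by
      rw [Fintype.bijective_iff_injective_and_card]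
      refine ⟨hinj, ?_⟩
      rw [Fintype.card_sum, Fintype.card_fin, Nat.add_sub_cancel' Γ.card_le]
    exact ⟨π' ∘ Sum.inl, hinj.comp Sum.inl_injective,
      (Γ.envyFree_padded_iff Γ' hG hM hd hMx π' hbij).1 hE⟩
end

section
/- Let G be a path on n ≥ 4 vertices and consider the distance preservation game on G with two agents a_1 and a_2, where M_{a_1} = {a_2} with d_{a_1}(a_2) = 1 and M_{a_2} = {a_1} with d_{a_2}(a_1) = 2. This game admits no jump stable allocation. -/
open Finset

variable {A V : Type} [Fintype A] [DecidableEq A] [Fintype V]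

namespace SimpleGraph

/-- The endpoints of a walk in a path graph differ by at most its length. -/
theorem natAbs_sub_le_length_of_walk_pathGraph {n : ℕ} {u v : Fin n}
    (w : (pathGraph n).Walk u v) : ((u : ℤ) - (v : ℤ)).natAbs ≤ w.length := by
  induction w with
  | nil => simp
  | cons h _ ih =>
    rw [pathGraph_adj] at h
    rw [Walk.length_cons]
    omega

theorem exists_walk_pathGraph_length_eq {n : ℕ} (k : ℕ) {u v : Fin n}
    (h : (u : ℕ) + k = v) : ∃ w : (pathGraph n).Walk u v, w.length = k := by
  induction k generalizing u with
  | zero =>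
    obtain rfl : u = v := Fin.ext h
    exact ⟨.nil, rfl⟩
  | succ k ih =>
    obtain ⟨w, hw⟩ := ih (u := ⟨u + 1, by omega⟩) (by simp only; omega)
    exact ⟨.cons (pathGraph_adj.2 (.inl rfl)) w, by rw [Walk.length_cons, hw]⟩

theorem dist_pathGraph {n : ℕ} (u v : Fin n) :
    (pathGraph n).dist u v = ((u : ℤ) - (v : ℤ)).natAbs := by
  apply le_antisymm
  · wlog h : (u : ℕ) ≤ v generalizing u v
    · rw [dist_comm, ← Int.natAbs_neg, neg_sub]
      exact this v u (by omega)
    · obtain ⟨w, hw⟩ := exists_walk_pathGraph_length_eq (v - u) (show (u : ℕ) + (v - u) = v by omega)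
      exact (dist_le w).trans (by omega)
  · obtain ⟨w, hw⟩ := (pathGraph_preconnected n u v).exists_walk_length_eq_dist
    exact hw ▸ natAbs_sub_le_length_of_walk_pathGraph w

end SimpleGraph

/-- On a path with `n ≥ 4` vertices, the game with two agents, where `a_1` wants
`a_2` at distance 1 and `a_2` wants `a_1` at distance 2, admits no jump stable allocation. -/
theorem path_two_agents_no_jumpStable (n : ℕ) (hn : 4 ≤ n)
    (Γ : DPG (Fin 2) (Fin n))
    (hG : Γ.G = SimpleGraph.pathGraph n)
    (hM0 : Γ.M 0 = {1}) (hM1 : Γ.M 1 = {0})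
    (hd0 : Γ.d 0 1 = 1) (hd1 : Γ.d 1 0 = 2) :
    ¬ ∃ π : Fin 2 → Fin n, Function.Injective π ∧ Γ.JumpStable π := by
  rintro ⟨π, hπ, hstable⟩
  have hne : (π 0 : ℕ) ≠ π 1 := fun h => absurd (hπ (Fin.ext h)) (by decide)
  have h₀ := (π 0).isLt
  have h₁ := (π 1).isLt
  by_cases hadj : ((π 0 : ℤ) - (π 1 : ℤ)).natAbs = 1
  · -- The second agent jumps to distance two from the first.
    obtain ⟨v, hv⟩ : ∃ v : Fin n, ((v : ℤ) - (π 0 : ℤ)).natAbs = 2 := by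
      by_cases h : (π 0 : ℕ) + 2 < n
      · exact ⟨⟨π 0 + 2, h⟩, by simp⟩
      · exact ⟨⟨π 0 - 2, by omega⟩, by simp only; omega⟩
    refine hstable 1 v (Fin.forall_fin_two.2 ⟨?_, ?_⟩) ?_
    · rintro rfl; omega
    · rintro rfl; omega
    · simp only [DPG.cost, hM1, sum_singleton, hG, hd1, SimpleGraph.dist_pathGraph,
        Function.update_self, Function.update_of_ne (zero_ne_one (α := Fin 2))]
      omega
  · -- The first agent jumps next to the second.
    obtain ⟨v, hv⟩ : ∃ v : Fin n, ((v : ℤ) - (π 1 : ℤ)).natAbs = 1 := by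
      by_cases h : (π 1 : ℕ) + 1 < n
      · exact ⟨⟨π 1 + 1, h⟩, by simp⟩
      · exact ⟨⟨π 1 - 1, by omega⟩, by simp only; omega⟩
    refine hstable 0 v (Fin.forall_fin_two.2 ⟨?_, ?_⟩) ?_
    · rintro rfl; omega
    · rintro rfl; omega
    · simp only [DPG.cost, hM0, sum_singleton, hG, hd0, SimpleGraph.dist_pathGraph,
        Function.update_self, Function.update_of_ne (one_ne_zero (α := Fin 2))]
      omega
end

section
/- Let G be the path on three vertices v_1 — v_2 — v_3 and consider the distance preservation game with agents a_1, a_2, a_3, where M_{a_i} = {a_1,a_2,a_3} \ {a_i} for each i, and the ideal distances are d_{a_1}(a_2) = 1, d_{a_1}(a_3) = 2, d_{a_2}(a_1) = 2, d_{a_2}(a_3) = 1, d_{a_3}(a_1) = 1, d_{a_3}(a_2) = 2. This game admits no swap stable allocation. -/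
open Finset

variable {A V : Type} [Fintype A] [DecidableEq A] [Fintype V]

lemma natAbs_sub_le_length_of_pathGraph_walk {n : ℕ} {u v : Fin n}
    (w : (SimpleGraph.pathGraph n).Walk u v) : ((u : ℤ) - (v : ℤ)).natAbs ≤ w.length := by
  induction w with
  | nil => simp
  | cons h w ih =>
    rw [SimpleGraph.pathGraph_adj] at h
    rw [SimpleGraph.Walk.length_cons]
    omega

lemma exists_pathGraph_walk_length_eq {n : ℕ} (k : ℕ) (u v : Fin n) (h : (u : ℕ) + k = v) :
    ∃ w : (SimpleGraph.pathGraph n).Walk u v, w.length = k := by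
  induction k generalizing u with
  | zero =>
    obtain rfl : u = v := Fin.ext h
    exact ⟨.nil, rfl⟩
  | succ k ih =>
    obtain ⟨w, hw⟩ := ih ⟨u + 1, by omega⟩ (by simp only; omega)
    exact ⟨.cons (SimpleGraph.pathGraph_adj.2 (.inl rfl)) w, by simp [hw]⟩

/-- Graph distance on a path is the absolute difference of the labels. -/
lemma dist_pathGraph {n : ℕ} (u v : Fin n) :
    (SimpleGraph.pathGraph n).dist u v = ((u : ℤ) - (v : ℤ)).natAbs := by
  apply le_antisymm
  · rcases le_total (u : ℕ) v with h | h
    · obtain ⟨w, hw⟩ := exists_pathGraph_walk_length_eq (v - u : ℕ) u v (by omega)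
      have := SimpleGraph.dist_le w
      omega
    · obtain ⟨w, hw⟩ := exists_pathGraph_walk_length_eq (u - v : ℕ) v u (by omega)
      have := SimpleGraph.dist_le w
      rw [SimpleGraph.dist_comm]
      omega
  · obtain ⟨w, hw⟩ :=
      (SimpleGraph.pathGraph_preconnected n u v).exists_walk_length_eq_dist
    exact hw ▸ natAbs_sub_le_length_of_pathGraph_walk w

/-- On the path with three vertices, the game with three agents, each caring about
both others, with ideal distances `d_{a_1}(a_2) = 1`, `d_{a_1}(a_3) = 2`, `d_{a_2}(a_1) = 2`,
`d_{a_2}(a_3) = 1`, `d_{a_3}(a_1) = 1`, `d_{a_3}(a_2) = 2`, admits no swap stable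
allocation. -/
theorem path3_no_swapStable (Γ : DPG (Fin 3) (Fin 3))
    (hG : Γ.G = SimpleGraph.pathGraph 3)
    (hM : ∀ i : Fin 3, Γ.M i = Finset.univ \ {i})
    (hd01 : Γ.d 0 1 = 1) (hd02 : Γ.d 0 2 = 2)
    (hd10 : Γ.d 1 0 = 2) (hd12 : Γ.d 1 2 = 1)
    (hd20 : Γ.d 2 0 = 1) (hd21 : Γ.d 2 1 = 2) :
    ¬ ∃ π : Fin 3 → Fin 3, Function.Injective π ∧ Γ.SwapStable π := by
  rintro ⟨π, hπ, hs⟩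
  have hcost : ∀ (ρ : Fin 3 → Fin 3) (a : Fin 3), Γ.cost ρ a = ∑ b ∈ Finset.univ \ {a},
      (((!![0, 1, 2; 2, 0, 1; 1, 2, 0] : Matrix (Fin 3) (Fin 3) ℕ) a b : ℤ) -
        (((ρ a : ℤ) - (ρ b : ℤ)).natAbs : ℤ)).natAbs := by
    intro ρ a
    rw [DPG.cost, hM a, hG]
    refine Finset.sum_congr rfl fun b hb => ?_
    rw [dist_pathGraph]
    fin_cases a <;> fin_cases b <;> simp_all
  simp only [DPG.SwapStable, hcost] at hs
  clear hcost
  revert π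
  decide
end

section
/- Every distance preservation game with symmetric preferences admits a jump stable allocation. -/
open Finset

variable {A V : Type} [Fintype A] [DecidableEq A] [Fintype V]

/-- A game has symmetric preferences if `b ∈ M_a` implies `a ∈ M_b` and `d_a(b) = d_b(a)`. -/
def DPG.Symmetric (Γ : DPG A V) : Prop :=
  ∀ a b : A, b ∈ Γ.M a → a ∈ Γ.M b ∧ Γ.d a b = Γ.d b a

/-- The contribution of the ordered pair `(a, b)` to the cost of `a` under `π`. -/
noncomputable def DPG.pairCost (Γ : DPG A V) (π : A → V) (a b : A) : ℕ :=
  if b ∈ Γ.M a then ((Γ.d a b : ℤ) - (Γ.G.dist (π a) (π b) : ℤ)).natAbs else 0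

theorem DPG.cost_eq_sum_pairCost (Γ : DPG A V) (π : A → V) (a : A) :
    Γ.cost π a = ∑ b, Γ.pairCost π a b := by
  simp [DPG.cost, DPG.pairCost, Finset.sum_ite_mem]

theorem DPG.pairCost_self (Γ : DPG A V) (π : A → V) (a : A) : Γ.pairCost π a a = 0 :=
  if_neg (Γ.M_irr a)

theorem DPG.Symmetric.pairCost_comm {Γ : DPG A V} (hsym : Γ.Symmetric) (π : A → V) (a b : A) :
    Γ.pairCost π a b = Γ.pairCost π b a := by
  unfold DPG.pairCost
  by_cases h : b ∈ Γ.M a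
  · obtain ⟨h', hd⟩ := hsym a b h
    rw [if_pos h, if_pos h', hd, SimpleGraph.dist_comm]
  · rw [if_neg h, if_neg fun h' => h (hsym b a h').1]

theorem DPG.pairCost_update_of_ne (Γ : DPG A V) (π : A → V) {x a b : A} (v : V)
    (ha : a ≠ x) (hb : b ≠ x) :
    Γ.pairCost (Function.update π x v) a b = Γ.pairCost π a b := by
  simp [DPG.pairCost, ha, hb]

/-- Under symmetric preferences, an agent's cost enters the total cost exactly twice. -/
theorem DPG.Symmetric.sum_cost_eq {Γ : DPG A V} (hsym : Γ.Symmetric) (π : A → V) (x : A) :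
    ∑ a, Γ.cost π a =
      2 * Γ.cost π x + ∑ a ∈ univ.erase x, ∑ b ∈ univ.erase x, Γ.pairCost π a b := by
  have hrow : Γ.cost π x = ∑ a ∈ univ.erase x, Γ.pairCost π a x := by
    rw [Γ.cost_eq_sum_pairCost, ← Finset.add_sum_erase _ _ (mem_univ x), Γ.pairCost_self,
      zero_add]
    exact Finset.sum_congr rfl fun b _ => hsym.pairCost_comm π x b
  have hrest : ∑ a ∈ univ.erase x, Γ.cost π a = ∑ a ∈ univ.erase x, Γ.pairCost π a x +
      ∑ a ∈ univ.erase x, ∑ b ∈ univ.erase x, Γ.pairCost π a b := by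
    rw [← Finset.sum_add_distrib]
    refine Finset.sum_congr rfl fun a _ => ?_
    rw [Γ.cost_eq_sum_pairCost, Finset.add_sum_erase _ _ (mem_univ x)]
  rw [← Finset.add_sum_erase _ _ (mem_univ x), hrest, ← hrow]
  ring

/-- Under symmetric preferences, an improving jump decreases the total cost. -/
theorem DPG.Symmetric.sum_cost_update_lt {Γ : DPG A V} (hsym : Γ.Symmetric) (π : A → V)
    {x : A} {v : V} (h : Γ.cost (Function.update π x v) x < Γ.cost π x) :
    ∑ a, Γ.cost (Function.update π x v) a < ∑ a, Γ.cost π a := by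
  rw [hsym.sum_cost_eq _ x, hsym.sum_cost_eq π x,
    Finset.sum_congr rfl fun a ha => Finset.sum_congr rfl fun b hb =>
      Γ.pairCost_update_of_ne π v (Finset.ne_of_mem_erase ha) (Finset.ne_of_mem_erase hb)]
  lia

theorem injective_update_of_forall_ne {α β : Type*} [DecidableEq α] {f : α → β}
    (hf : Function.Injective f) {x : α} {v : β} (hv : ∀ b, f b ≠ v) :
    Function.Injective (Function.update f x v) := by
  intro a b hab
  rcases eq_or_ne a x with ha | ha <;> rcases eq_or_ne b x with hb | hb
  · rw [ha, hb]
  · rw [ha, Function.update_self, Function.update_of_ne hb] at hab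
    exact absurd hab.symm (hv b)
  · rw [hb, Function.update_self, Function.update_of_ne ha] at hab
    exact absurd hab (hv a)
  · rw [Function.update_of_ne ha, Function.update_of_ne hb] at hab
    exact hf hab

/-- Every distance preservation game with symmetric preferences admits a jump
stable allocation. -/
theorem symmetric_exists_jumpStable (Γ : DPG A V) (hsym : Γ.Symmetric) :
    ∃ π : A → V, Function.Injective π ∧ Γ.JumpStable π := by
  obtain ⟨e⟩ := Function.Embedding.nonempty_of_card_le Γ.card_le
  have hne : {π : A → V | Function.Injective π}.Nonempty := ⟨e, e.injective⟩
  obtain ⟨π, hπ, hmin⟩ := exists_minimalFor_of_wellFoundedLT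
    (fun π : A → V => Function.Injective π) (fun π => ∑ a, Γ.cost π a) hne
  refine ⟨π, hπ, fun a v hv hlt => ?_⟩
  have hsum := hsym.sum_cost_update_lt π hlt
  exact hsum.not_ge (hmin (injective_update_of_forall_ne hπ hv) hsum.le)
end

section
/- Let Γ be a distance preservation game with symmetric preferences, and define the potential P(π) = Σ_{a ∈ A} Σ_{b ∈ M_a} | min(d_a(b), |V(G)|) − dist_G(π(a),π(b)) | for every allocation π. Then for every allocation π, every agent a, and every empty vertex v, one has P(π) − P(π^{a↦v}) = 2 · (cost(a,π) − cost(a,π^{a↦v})), where the difference is taken in the integers. -/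
open Finset

variable {A V : Type} [Fintype A] [DecidableEq A] [Fintype V]

/-- The potential of an allocation: the sum over all agents `a` and all `b ∈ M_a` of
`|min(d_a(b), |V|) − dist(π(a), π(b))|`. -/
noncomputable def DPG.pot (Γ : DPG A V) (π : A → V) : ℕ :=
  ∑ a : A, ∑ b ∈ Γ.M a,
    ((min (Γ.d a b) (Fintype.card V) : ℤ) - (Γ.G.dist (π a) (π b) : ℤ)).natAbs

/-- The distance of two vertices of a finite connected graph is less than the number of
vertices. -/
theorem SimpleGraph.Connected.dist_lt_card {W : Type*} [Fintype W] {G : SimpleGraph W}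
    (hG : G.Connected) (u w : W) : G.dist u w < Fintype.card W := by
  obtain ⟨p, hp, hlen⟩ := hG.exists_path_of_dist u w
  exact hlen ▸ hp.length_lt

/-- If a symmetric matrix vanishes outside the row and the column of `a`, and also at `(a, a)`,
then the sum of its entries is twice the sum of row `a`. -/
theorem sum_sum_eq_two_mul_sum_of_symm {ι : Type*} [Fintype ι] [DecidableEq ι]
    (D : ι → ι → ℤ) (a : ι) (hsymm : ∀ x y, D x y = D y x)
    (hzero : ∀ x y, x ≠ a → y ≠ a → D x y = 0) (hdiag : D a a = 0) :
    ∑ x, ∑ y, D x y = 2 * ∑ y, D a y := by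
  have hrow : ∀ x, ∑ y, D x y = D a x + if x = a then ∑ y, D a y else 0 := by
    intro x
    by_cases hx : x = a
    · subst hx
      simp [hdiag]
    · rw [Fintype.sum_eq_single a fun y hy => hzero x y hx hy]
      simp [hx, hsymm x a]
  rw [Finset.sum_congr rfl fun x _ => hrow x, Finset.sum_add_distrib,
    Finset.sum_ite_eq', if_pos (Finset.mem_univ a)]
  ring

/-- The contribution of the ordered pair `(x, y)` to the potential of `π`. -/
noncomputable def DPG.potTerm (Γ : DPG A V) (π : A → V) (x y : A) : ℤ :=
  if y ∈ Γ.M x then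
    |(min (Γ.d x y) (Fintype.card V) : ℤ) - (Γ.G.dist (π x) (π y) : ℤ)|
  else 0

theorem DPG.pot_eq_sum_potTerm (Γ : DPG A V) (π : A → V) :
    (Γ.pot π : ℤ) = ∑ x, ∑ y, Γ.potTerm π x y := by
  simp [DPG.pot, DPG.potTerm, Finset.sum_ite_mem]

theorem DPG.potTerm_self (Γ : DPG A V) (π : A → V) (x : A) : Γ.potTerm π x x = 0 :=
  if_neg (Γ.M_irr x)

theorem DPG.Symmetric.potTerm_comm {Γ : DPG A V} (hsym : Γ.Symmetric) (π : A → V) (x y : A) :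
    Γ.potTerm π x y = Γ.potTerm π y x := by
  unfold DPG.potTerm
  by_cases h : y ∈ Γ.M x
  · obtain ⟨h', hd⟩ := hsym x y h
    rw [if_pos h, if_pos h', hd, SimpleGraph.dist_comm]
  · rw [if_neg h, if_neg fun h' => h (hsym y x h').1]

/-- Capping the ideal distances at `|V|` changes the cost of an agent by an amount that does not
depend on the allocation. -/
theorem DPG.cost_eq_sum_potTerm_add (Γ : DPG A V) (π : A → V) (a : A) :
    (Γ.cost π a : ℤ) = ∑ y, Γ.potTerm π a y +
      ∑ y ∈ Γ.M a, ((Γ.d a y : ℤ) - min (Γ.d a y : ℤ) (Fintype.card V)) := by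
  simp only [DPG.cost, DPG.potTerm, Finset.sum_ite_mem, Finset.univ_inter, Nat.cast_sum,
    Int.natCast_natAbs]
  rw [← Finset.sum_add_distrib]
  refine Finset.sum_congr rfl fun y _ => ?_
  have hlt := Γ.conn.dist_lt_card (π a) (π y)
  rcases le_total (Γ.d a y : ℤ) (Fintype.card V) with h | h
  · simp [min_eq_left h]
  · rw [min_eq_right h, abs_of_nonneg (by omega), abs_of_nonneg (by omega)]
    ring

/-- In a game with symmetric preferences, a jump of agent `a` to an empty vertex
`v` changes the potential by exactly twice the change of the cost of `a`. -/
theorem symmetric_pot_jump (Γ : DPG A V) (hsym : Γ.Symmetric)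
    (π : A → V) (hπ : Function.Injective π) (a : A) (v : V) (hv : ∀ b : A, π b ≠ v) :
    (Γ.pot π : ℤ) - (Γ.pot (Function.update π a v) : ℤ) =
      2 * ((Γ.cost π a : ℤ) - (Γ.cost (Function.update π a v) a : ℤ)) := by
  rw [Γ.pot_eq_sum_potTerm, Γ.pot_eq_sum_potTerm, Γ.cost_eq_sum_potTerm_add,
    Γ.cost_eq_sum_potTerm_add, add_sub_add_right_eq_sub]
  simp only [← Finset.sum_sub_distrib]
  refine sum_sum_eq_two_mul_sum_of_symm _ a (fun x y => ?_) (fun x y hx hy => ?_) ?_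
  · rw [hsym.potTerm_comm π, hsym.potTerm_comm (Function.update π a v)]
  · simp [DPG.potTerm, hx, hy]
  · simp [DPG.potTerm_self]
end

section
/- Let Γ be a distance preservation game with symmetric preferences, and define the potential P(π) = Σ_{a ∈ A} Σ_{b ∈ M_a} | min(d_a(b), |V(G)|) − dist_G(π(a),π(b)) | for every allocation π. Then for every allocation π and every pair of distinct agents a, b, one has P(π) − P(π^{a↔b}) = 2 · (cost(a,π) − cost(a,π^{a↔b}) + cost(b,π) − cost(b,π^{a↔b})), where the differences are taken in the integers. -/
open Finset

variable {A V : Type} [Fintype A] [DecidableEq A] [Fintype V]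

theorem SimpleGraph.Connected.dist_le_card {G : SimpleGraph V} (h : G.Connected) (u v : V) :
    G.dist u v ≤ Fintype.card V := by
  obtain ⟨p, hp, hlen⟩ := h.exists_path_of_dist u v
  exact hlen ▸ hp.length_lt.le

/-- A symmetric integer matrix supported on the rows and columns of `a` and `b`, and vanishing
where these meet, has total sum twice the sum of its rows `a` and `b`. -/
theorem sum_sum_eq_two_mul_of_symm (f : A → A → ℤ) (a b : A) (hab : a ≠ b)
    (symm : ∀ x y, f x y = f y x) (haa : f a a = 0) (hbb : f b b = 0) (hf : f a b = 0)
    (supp : ∀ x y, x ≠ a → x ≠ b → y ≠ a → y ≠ b → f x y = 0) :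
    ∑ x, ∑ y, f x y = 2 * (∑ y, f a y + ∑ y, f b y) := by
  have key : ∀ x y, f x y = (if x = a then f a y else 0) + (if x = b then f b y else 0) +
      (if y = a then f a x else 0) + (if y = b then f b x else 0) := by
    intro x y
    grind
  have rows : ∀ x, ∑ y, f x y = (if x = a then ∑ y, f a y else 0) +
      (if x = b then ∑ y, f b y else 0) + f a x + f b x := by
    intro x
    rw [sum_congr rfl fun y _ => key x y]
    simp only [sum_add_distrib, sum_ite_eq', mem_univ, if_true]
    split_ifs <;> simp
  rw [sum_congr rfl fun x _ => rows x]
  simp only [sum_add_distrib, sum_ite_eq', mem_univ, if_true]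
  ring

/-- The decrease of the cost contribution of `y` to `x` when passing from `π` to `σ`. -/
noncomputable def DPG.costDrop (Γ : DPG A V) (π σ : A → V) (x y : A) : ℤ :=
  if y ∈ Γ.M x then
    |(Γ.d x y : ℤ) - Γ.G.dist (π x) (π y)| - |(Γ.d x y : ℤ) - Γ.G.dist (σ x) (σ y)|
  else 0

theorem DPG.cost_sub_cost (Γ : DPG A V) (π σ : A → V) (x : A) :
    (Γ.cost π x : ℤ) - Γ.cost σ x = ∑ y, Γ.costDrop π σ x y := by
  simp [DPG.cost, DPG.costDrop, ← sum_sub_distrib, sum_ite_mem]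

theorem DPG.pot_sub_pot (Γ : DPG A V) (π σ : A → V) :
    (Γ.pot π : ℤ) - Γ.pot σ = ∑ x, ∑ y, Γ.costDrop π σ x y := by
  simp only [DPG.pot, DPG.costDrop, Nat.cast_sum, ← sum_sub_distrib, sum_ite_mem, univ_inter]
  refine sum_congr rfl fun x _ => sum_congr rfl fun y _ => ?_
  have h₁ := Γ.conn.dist_le_card (π x) (π y)
  have h₂ := Γ.conn.dist_le_card (σ x) (σ y)
  rw [← Int.natCast_natAbs, ← Int.natCast_natAbs]
  omega

theorem DPG.Symmetric.costDrop_comm {Γ : DPG A V} (h : Γ.Symmetric) (π σ : A → V) (x y : A) :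
    Γ.costDrop π σ x y = Γ.costDrop π σ y x := by
  have hxy := h x y
  have hyx := h y x
  simp only [DPG.costDrop, Γ.G.dist_comm (u := π y), Γ.G.dist_comm (u := σ y)]
  grind

/-- In a game with symmetric preferences, a swap of two distinct agents `a`, `b`
changes the potential by exactly twice the sum of the changes of the costs of `a` and `b`. -/
theorem symmetric_pot_swap (Γ : DPG A V) (hsym : Γ.Symmetric)
    (π : A → V) (hπ : Function.Injective π) (a b : A) (hab : a ≠ b) :
    (Γ.pot π : ℤ) - (Γ.pot (swapAlloc π a b) : ℤ) =
      2 * (((Γ.cost π a : ℤ) - (Γ.cost (swapAlloc π a b) a : ℤ)) +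
        ((Γ.cost π b : ℤ) - (Γ.cost (swapAlloc π a b) b : ℤ))) := by
  rw [Γ.pot_sub_pot, Γ.cost_sub_cost, Γ.cost_sub_cost]
  refine sum_sum_eq_two_mul_of_symm _ a b hab (hsym.costDrop_comm _ _) ?_ ?_ ?_ ?_
  · simp [DPG.costDrop, Γ.M_irr]
  · simp [DPG.costDrop, Γ.M_irr]
  · simp [DPG.costDrop, swapAlloc, Γ.G.dist_comm (u := π b)]
  · intro x y hxa hxb hya hyb
    simp [DPG.costDrop, swapAlloc, Equiv.swap_apply_of_ne_of_ne, *]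
end

section
/- If the preference graph D_pref of a distance preservation game is acyclic, then the game admits an allocation that is simultaneously jump stable and swap stable. -/
open Finset

variable {A V : Type} [Fintype A] [DecidableEq A] [Fintype V]

/-- The cost of an agent only depends on the positions of that agent and of its relations. -/
theorem DPG.cost_congr (Γ : DPG A V) {π σ : A → V} {a : A} (ha : σ a = π a)
    (hM : ∀ b ∈ Γ.M a, σ b = π b) : Γ.cost σ a = Γ.cost π a := by
  unfold DPG.cost
  refine Finset.sum_congr rfl fun b hb => ?_
  rw [ha, hM b hb]

/-- For a strict well-order of the agents in which every agent comes after its relations, some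
injective allocation has the property that no injective allocation agreeing with it on all agents
before `a` is strictly better for `a`. -/
theorem DPG.exists_injective_forall_cost_le (Γ : DPG A V) (s : A → A → Prop) [IsWellOrder A s]
    (hs : ∀ a, ∀ b ∈ Γ.M a, s b a) :
    ∃ π : A → V, Function.Injective π ∧ ∀ σ : A → V, Function.Injective σ →
      ∀ a, (∀ b, s b a → σ b = π b) → Γ.cost π a ≤ Γ.cost σ a := by
  have hwf : WellFounded (Pi.Lex s (fun {_ : A} => ((· < ·) : ℕ → ℕ → Prop))) :=
    Pi.Lex.wellFounded s fun _ => wellFounded_lt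
  obtain ⟨f⟩ := Function.Embedding.nonempty_of_card_le Γ.card_le
  obtain ⟨π, hπ, hmin⟩ := (InvImage.wf (fun π : A → V => Γ.cost π) hwf).has_min
    {π | Function.Injective π} ⟨f, f.injective⟩
  refine ⟨π, hπ, fun σ hσ a hagree => not_lt.1 fun hlt => ?_⟩
  refine hmin σ hσ ⟨a, fun b hb => ?_, hlt⟩
  exact Γ.cost_congr (hagree b hb) fun c hc => hagree c (_root_.trans (hs b c hc) hb)

theorem swapAlloc_comm {B W : Type} [DecidableEq B] (π : B → W) (a b : B) :
    swapAlloc π a b = swapAlloc π b a := by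
  rw [swapAlloc, Equiv.swap_comm, swapAlloc]

theorem swapAlloc_injective {B W : Type} [DecidableEq B] {π : B → W}
    (hπ : Function.Injective π) (a b : B) : Function.Injective (swapAlloc π a b) :=
  hπ.comp (Equiv.swap a b).injective

theorem swapAlloc_of_ne_of_ne {B W : Type} [DecidableEq B] (π : B → W) {a b c : B}
    (ha : c ≠ a) (hb : c ≠ b) : swapAlloc π a b c = π c := by
  rw [swapAlloc, Function.comp_apply, Equiv.swap_apply_of_ne_of_ne ha hb]

/-- Moving one agent to an empty vertex keeps an allocation injective. -/
theorem update_injective_of_empty {B W : Type} [DecidableEq B] {π : B → W}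
    (hπ : Function.Injective π) (a : B) {v : W} (hv : ∀ b, π b ≠ v) :
    Function.Injective (Function.update π a v) := by
  intro x y hxy
  by_cases hx : x = a <;> by_cases hy : y = a
  · exact hx.trans hy.symm
  · simp_all [(hv y).symm]
  · simp_all
  · exact hπ (by simpa [hx, hy] using hxy)

/-- If the preference graph (with an arc from `a` to `b` iff `b ∈ M_a`) is
acyclic — equivalently, on a finite agent set, the arc relation is well-founded — then the
game admits an allocation that is simultaneously jump stable and swap stable. -/
theorem acyclic_exists_jump_and_swapStable (Γ : DPG A V)
    (hacyc : WellFounded (fun b a : A => b ∈ Γ.M a)) :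
    ∃ π : A → V, Function.Injective π ∧ Γ.JumpStable π ∧ Γ.SwapStable π := by
  have : IsWellFounded A fun b a : A => b ∈ Γ.M a := ⟨hacyc⟩
  obtain ⟨s, hs, hwo⟩ := IsWellFounded.exists_well_order_ge fun b a : A => b ∈ Γ.M a
  obtain ⟨π, hπ, hopt⟩ := Γ.exists_injective_forall_cost_le s fun a b hb => hs b a hb
  have hswap : ∀ a b, s a b → Γ.cost π a ≤ Γ.cost (swapAlloc π a b) a := fun a b hab =>
    hopt _ (swapAlloc_injective hπ a b) a fun c hc =>
      swapAlloc_of_ne_of_ne π (ne_of_irrefl hc) (ne_of_irrefl (_root_.trans hc hab))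
  refine ⟨π, hπ, fun a v hv => ?_, fun a b hab ⟨ha, hb⟩ => ?_⟩
  · exact not_lt.2 (hopt _ (update_injective_of_empty hπ a hv) a fun c hc =>
      Function.update_of_ne (ne_of_irrefl hc) v π)
  · rcases trichotomous_of s a b with h | h | h
    · exact (hswap a b h).not_gt ha
    · exact hab h
    · exact (hswap b a h).not_gt (swapAlloc_comm π a b ▸ hb)
end

section
/- Let Γ be a distance preservation game whose topology G has at least two vertices, let d be the diameter of G, and let n = |A| be the number of agents. If |V(G)| ≥ d^{d·n}, then Γ admits an envy-free allocation. -/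
open Finset

variable {A V : Type} [Fintype A] [DecidableEq A] [Fintype V]

/-- Multicolour Ramsey theorem: if the pairs of distinct points of `S` are coloured symmetrically
with `#C ≥ 2` colours and `S` has at least `#C ^ (∑ c ∈ C, f c)` points, then for some colour `c`
there is a set of `f c + 1` points all of whose pairs have colour `c`. -/
theorem exists_monochromatic_subset {W ι : Type*} (col : W → W → ι)
    (hsymm : ∀ u v, col u v = col v u) (C : Finset ι) (hC : 2 ≤ #C) (f : ι → ℕ) (S : Finset W)
    (hcol : ∀ u ∈ S, ∀ v ∈ S, u ≠ v → col u v ∈ C) (hS : #C ^ (∑ c ∈ C, f c) ≤ #S) :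
    ∃ c ∈ C, ∃ T ⊆ S, #T = f c + 1 ∧ ∀ u ∈ T, ∀ v ∈ T, u ≠ v → col u v = c := by
  classical
  induction hs : ∑ c ∈ C, f c generalizing f S with
  | zero =>
    obtain ⟨c, hc⟩ : C.Nonempty := card_pos.mp (by omega)
    have hfc : f c = 0 := (sum_eq_zero_iff.mp hs) c hc
    obtain ⟨v, hv⟩ : S.Nonempty := card_pos.mp (lt_of_lt_of_le (by positivity) hS)
    exact ⟨c, hc, {v}, by simpa using hv, by simp [hfc], by simp⟩
  | succ s ih =>
    obtain ⟨v, hv⟩ : S.Nonempty := card_pos.mp (lt_of_lt_of_le (by positivity) hS)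
    by_cases h0 : ∃ c ∈ C, f c = 0
    · obtain ⟨c, hc, hfc⟩ := h0
      exact ⟨c, hc, {v}, by simpa using hv, by simp [hfc], by simp⟩
    push Not at h0
    obtain ⟨c, hc, hN⟩ : ∃ c ∈ C, #C ^ s ≤ #{u ∈ S.erase v | col v u = c} := by
      by_contra! hlt
      have hsum : #(S.erase v) = ∑ c ∈ C, #{u ∈ S.erase v | col v u = c} :=
        card_eq_sum_card_fiberwise fun u hu =>
          hcol v hv u (mem_of_mem_erase hu) (ne_of_mem_erase hu).symm
      have hle : ∑ c ∈ C, (#{u ∈ S.erase v | col v u = c} + 1) ≤ ∑ _c ∈ C, #C ^ s :=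
        sum_le_sum hlt
      rw [sum_add_distrib, ← hsum, card_erase_of_mem hv] at hle
      simp only [sum_const, smul_eq_mul, mul_one] at hle
      rw [hs, pow_succ'] at hS
      omega
    have hsub : {u ∈ S.erase v | col v u = c} ⊆ S :=
      (filter_subset _ _).trans (erase_subset _ _)
    have hg : ∑ i ∈ C, Function.update f c (f c - 1) i = s := by
      rw [sum_update_of_mem hc]
      have hsplit := add_sum_erase C f hc
      rw [← sdiff_singleton_eq_erase] at hsplit
      have := h0 c hc
      omega
    obtain ⟨c', hc', T, hTS, hT, hmono⟩ := ih (Function.update f c (f c - 1)) _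
      (fun u hu w hw => hcol u (hsub hu) w (hsub hw)) (hg ▸ hN) hg
    by_cases hcc : c' = c
    · subst hcc
      have hvT : v ∉ T := fun hvT => by simpa using hTS hvT
      have hcolv : ∀ u ∈ T, col v u = c' := fun u hu => (mem_filter.mp (hTS hu)).2
      refine ⟨c', hc, insert v T, insert_subset hv (hTS.trans hsub), ?_, ?_⟩
      · have := h0 c' hc
        rw [card_insert_of_notMem hvT, hT, Function.update_self]
        omega
      · intro u hu w hw huw
        rcases mem_insert.mp hu with rfl | huT <;> rcases mem_insert.mp hw with rfl | hwT
        · exact absurd rfl huw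
        · exact hcolv w hwT
        · rw [hsymm]
          exact hcolv u huT
        · exact hmono u huT w hwT huw
    · rw [Function.update_of_ne hcc] at hT
      exact ⟨c', hc', T, hTS.trans hsub, hT, hmono⟩

/-- An allocation to pairwise equidistant vertices is envy-free. -/
theorem DPG.envyFree_of_equidistant (Γ : DPG A V) {π : A → V} {c : ℕ}
    (h : ∀ a b, a ≠ b → Γ.G.dist (π a) (π b) = c) : Γ.EnvyFree π := by
  intro a b _
  refine (Eq.le ?_).not_gt
  refine sum_congr rfl fun x hx => ?_
  have hax : a ≠ x := fun hax => Γ.M_irr a (hax ▸ hx)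
  simp only [swapAlloc, Function.comp_apply]
  rw [h a x hax, h _ _ ((Equiv.swap a b).injective.ne hax)]

/-- If the topology of a game has at least two vertices and at least
`d ^ (d * n)` vertices, where `d` is its diameter and `n` the number of agents, then the
game admits an envy-free allocation. -/
theorem large_graph_exists_envyFree (Γ : DPG A V) (hV : 2 ≤ Fintype.card V)
    (h : Γ.G.diam ^ (Γ.G.diam * Fintype.card A) ≤ Fintype.card V) :
    ∃ π : A → V, Function.Injective π ∧ Γ.EnvyFree π := by
  have hd : ∀ u v, Γ.G.dist u v ≤ Γ.G.diam := fun u v => by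
    have := Γ.conn.nonempty
    exact SimpleGraph.dist_le_diam (SimpleGraph.connected_iff_ediam_ne_top.mp Γ.conn)
  have hpos : ∀ u v, u ≠ v → 1 ≤ Γ.G.dist u v := fun u v => Γ.conn.pos_dist_of_ne
  rcases Nat.lt_or_ge Γ.G.diam 2 with hd1 | hd2
  · obtain ⟨π⟩ := Function.Embedding.nonempty_of_card_le Γ.card_le
    refine ⟨π, π.injective, Γ.envyFree_of_equidistant (c := 1) fun a b hab => ?_⟩
    have := hd (π a) (π b)
    have := hpos _ _ (π.injective.ne hab)
    omega
  · obtain ⟨c, -, T, -, hT, hmono⟩ := exists_monochromatic_subset Γ.G.dist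
      (fun _ _ => SimpleGraph.dist_comm) (Icc 1 Γ.G.diam) (by simpa using hd2)
      (fun _ => Fintype.card A) univ
      (fun u _ v _ huv => mem_Icc.mpr ⟨hpos u v huv, hd u v⟩) (by simpa using h)
    obtain ⟨e⟩ : Nonempty (A ↪ T) :=
      Function.Embedding.nonempty_of_card_le (by simp [hT])
    exact ⟨fun a => e a, Subtype.val_injective.comp e.injective,
      Γ.envyFree_of_equidistant fun a b hab =>
        hmono _ (e a).2 _ (e b).2 (Subtype.val_injective.ne (e.injective.ne hab))⟩
end

section
/- If in a distance preservation game at most one agent a* has a nonempty relationship set (i.e., M_b = ∅ for every agent b ≠ a*), then the game admits an envy-free allocation. -/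
open Finset

variable {A V : Type} [Fintype A] [DecidableEq A] [Fintype V]

/-- Some injective allocation minimizes the cost of a given agent. -/
theorem DPG.exists_minimal_cost (Γ : DPG A V) (a : A) {π₀ : A → V}
    (hπ₀ : Function.Injective π₀) :
    ∃ π : A → V, Function.Injective π ∧
      ∀ π' : A → V, Function.Injective π' → Γ.cost π a ≤ Γ.cost π' a := by
  obtain ⟨π, hπ, hmin⟩ := exists_minimalFor_of_wellFoundedLT
    Function.Injective (fun π => Γ.cost π a) ⟨π₀, hπ₀⟩
  exact ⟨π, hπ, fun π' hπ' => (le_total _ _).elim id (hmin hπ')⟩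

/-- If at most one agent `a*` has a nonempty relationship set (the preference
graph is an out-star centered at `a*`), then the game admits an envy-free allocation. -/
theorem outStar_exists_envyFree (Γ : DPG A V) (astar : A)
    (h : ∀ b : A, b ≠ astar → Γ.M b = ∅) :
    ∃ π : A → V, Function.Injective π ∧ Γ.EnvyFree π := by
  obtain ⟨f⟩ := Function.Embedding.nonempty_of_card_le Γ.card_le
  obtain ⟨π, hπ, hmin⟩ := Γ.exists_minimal_cost astar f.injective
  refine ⟨π, hπ, fun a b _ => ?_⟩
  rcases eq_or_ne a astar with rfl | ha
  · exact not_lt.mpr (hmin _ (hπ.comp (Equiv.swap a b).injective))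
  · simp [DPG.cost, h a ha]
end
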